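/- Suppose the limit L = lim_{n→∞} (M_n)^{1/n} exists and satisfies L ≥ √11.38. Then liminf_{n→∞} (M^{Irr}_n)^{1/n} ≥ 11.38^{1/4}. -/

import Mathlib

open Filter

/-- `x` lies strictly between `p` and `q`. -/
def StrictlyBetween (p q x : ℕ) : Prop := min p q < x ∧ x < max p q

/-- Two arcs `{p, q}` and `{r, s}` cross if exactly one of `r`, `s` lies strictly
between `p` and `q`. -/
def ArcsCross (p q r s : ℕ) : Prop :=
  Xor' (StrictlyBetween p q r) (StrictlyBetween p q s)

/-- `a` (with one-based indexing, only the values `a 1, …, a n` being relevant)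
is an open meandric permutation of order `n`: it is a permutation of `{1, …, n}`
with `a i ≡ i (mod 2)`, whose upper arcs (pairs `{a i, a (i+1)}` for odd `i < n`)
are pairwise noncrossing, whose lower arcs (pairs `{a i, a (i+1)}` for even
`1 ≤ i < n`) are pairwise noncrossing, such that no lower arc strictly encloses
`a 1`, and no lower arc (if `n` is even) resp. upper arc (if `n` is odd)
strictly encloses `a n`. -/
def IsOpenMeandricPerm (n : ℕ) (a : ℕ → ℕ) : Prop :=
  1 ≤ n ∧
  (∀ i, 1 ≤ i → i ≤ n → 1 ≤ a i ∧ a i ≤ n) ∧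
  (∀ i j, 1 ≤ i → i ≤ n → 1 ≤ j → j ≤ n → a i = a j → i = j) ∧
  (∀ i, 1 ≤ i → i ≤ n → a i % 2 = i % 2) ∧
  (∀ i j, Odd i → i < n → Odd j → j < n →
      ¬ ArcsCross (a i) (a (i + 1)) (a j) (a (j + 1))) ∧
  (∀ i j, Even i → 1 ≤ i → i < n → Even j → 1 ≤ j → j < n →
      ¬ ArcsCross (a i) (a (i + 1)) (a j) (a (j + 1))) ∧
  (∀ i, Even i → 1 ≤ i → i < n → ¬ StrictlyBetween (a i) (a (i + 1)) (a 1)) ∧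
  (if Even n
    then ∀ i, Even i → 1 ≤ i → i < n → ¬ StrictlyBetween (a i) (a (i + 1)) (a n)
    else ∀ i, Odd i → i < n → ¬ StrictlyBetween (a i) (a (i + 1)) (a n))

/-- An open meandric permutation of order `n` is irreducible if there are no
indices `1 ≤ k₁ < k₂ ≤ n` with `2 < k₂ - k₁ ≤ n - 2` such that the values
`a k₁, …, a k₂` form an interval of integers, i.e. their max minus their min
equals `k₂ - k₁`. -/
def IsIrreducibleMeander (n : ℕ) (a : ℕ → ℕ) : Prop :=
  ¬ ∃ k₁ k₂ : ℕ, ∃ h : k₁ < k₂, 1 ≤ k₁ ∧ k₂ ≤ n ∧ 2 < k₂ - k₁ ∧ k₂ - k₁ ≤ n - 2 ∧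
    (Finset.Icc k₁ k₂).sup' (Finset.nonempty_Icc.mpr h.le) a -
      (Finset.Icc k₁ k₂).inf' (Finset.nonempty_Icc.mpr h.le) a = k₂ - k₁

/-- An open meandric permutation of order `n` is prime if `a 1 ≠ 1` and no proper
initial segment `a 1, …, a j` (`2 ≤ j < n`) is a permutation of `{1, …, j}`. -/
def IsPrimeMeander (n : ℕ) (a : ℕ → ℕ) : Prop :=
  a 1 ≠ 1 ∧ ¬ ∃ j, 2 ≤ j ∧ j < n ∧ (Finset.Icc 1 j).image a = Finset.Icc 1 j

/-- `a` (with one-based indexing) is a closed meandric permutation of order `n`: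
a permutation of `{1, …, 2n}` with `a 1 = 1`, `a i ≡ i (mod 2)`, pairwise
noncrossing upper arcs `{a i, a (i+1)}` (odd `i < 2n`) and pairwise noncrossing
lower arcs, the latter being the `{a i, a (i+1)}` for even `1 ≤ i < 2n` together
with the wrap-around arc `{a (2n), a 1}`. -/
def IsClosedMeandricPerm (n : ℕ) (a : ℕ → ℕ) : Prop :=
  1 ≤ n ∧ a 1 = 1 ∧
  (∀ i, 1 ≤ i → i ≤ 2 * n → 1 ≤ a i ∧ a i ≤ 2 * n) ∧
  (∀ i j, 1 ≤ i → i ≤ 2 * n → 1 ≤ j → j ≤ 2 * n → a i = a j → i = j) ∧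
  (∀ i, 1 ≤ i → i ≤ 2 * n → a i % 2 = i % 2) ∧
  (∀ i j, Odd i → i < 2 * n → Odd j → j < 2 * n →
      ¬ ArcsCross (a i) (a (i + 1)) (a j) (a (j + 1))) ∧
  (∀ i j, Even i → 1 ≤ i → i < 2 * n → Even j → 1 ≤ j → j < 2 * n →
      ¬ ArcsCross (a i) (a (i + 1)) (a j) (a (j + 1))) ∧
  (∀ i, Even i → 1 ≤ i → i < 2 * n →
      ¬ ArcsCross (a i) (a (i + 1)) (a (2 * n)) (a 1) ∧
      ¬ ArcsCross (a (2 * n)) (a 1) (a i) (a (i + 1)))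

/-- `M n`: the number of open meandric permutations of order `n` (each counted
once via the normalization `a i = 0` outside `{1, …, n}`). -/
noncomputable def openMeanderCount (n : ℕ) : ℕ :=
  Set.ncard {a : ℕ → ℕ | IsOpenMeandricPerm n a ∧ ∀ i, i < 1 ∨ n < i → a i = 0}

/-- `M^{Irr} n`: the number of irreducible open meandric permutations of order `n`. -/
noncomputable def irrMeanderCount (n : ℕ) : ℕ :=
  Set.ncard {a : ℕ → ℕ | IsOpenMeandricPerm n a ∧ IsIrreducibleMeander n a ∧
    ∀ i, i < 1 ∨ n < i → a i = 0}

/-- `M^{(P)} n`: the number of prime open meandric permutations of order `n`. -/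
noncomputable def primeMeanderCount (n : ℕ) : ℕ :=
  Set.ncard {a : ℕ → ℕ | IsOpenMeandricPerm n a ∧ IsPrimeMeander n a ∧
    ∀ i, i < 1 ∨ n < i → a i = 0}

/-- `M̄ n`: the number of closed meandric permutations of order `n`. -/
noncomputable def closedMeanderCount (n : ℕ) : ℕ :=
  Set.ncard {a : ℕ → ℕ | IsClosedMeandricPerm n a ∧ ∀ i, i < 1 ∨ 2 * n < i → a i = 0}

/-- An open meandric permutation `g` of order `N`, normalized to vanish outside `{1, …, N}`, with
no proper interval window of length at least four, together with two places `i < j` at which it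
takes consecutive values `c`, `c + 1` and between which it takes values on both sides of these. -/
structure IsGadget (N : ℕ) (g : ℕ → ℕ) (i j c : ℕ) : Prop where
  perm : IsOpenMeandricPerm N g
  zero : ∀ k, k < 1 ∨ N < k → g k = 0
  one_le : 1 ≤ i
  lt : i < j
  le : j ≤ N
  odd : i % 2 = 1
  left : g i = c
  right : g j = c + 1
  low : ∃ k, i < k ∧ k < j ∧ g k < c
  high : ∃ k, i < k ∧ k < j ∧ c + 1 < g k
  simple : ∀ k₁ k₂, 1 ≤ k₁ → k₂ ≤ N → k₁ + 3 ≤ k₂ → ¬ (k₁ = 1 ∧ k₂ = N) →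
    ∃ k l, k₁ ≤ k ∧ k ≤ k₂ ∧ k₁ ≤ l ∧ l ≤ k₂ ∧ g l + (k₂ - k₁) < g k

/-- The strictly monotone map that makes room for `2 m` values in place of `c`, `c + 1`, these two
being sent to the two copies of `e`. -/
def blowUp (c m e v : ℕ) : ℕ :=
  if v < c then v else if v = c then c + 2 * e - 2 else if v = c + 1 then c + 2 * e - 1
  else v + 2 * m - 2

/-- The `t`-th value on the forward strand of the doubled curve `a`. -/
def forwardStrand (c : ℕ) (a : ℕ → ℕ) (t : ℕ) : ℕ := c + 2 * a t - t % 2 - 1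

/-- The `t`-th value on the backward strand of the doubled curve `a`. -/
def backwardStrand (c : ℕ) (a : ℕ → ℕ) (t : ℕ) : ℕ := c + 2 * a t - (t + 1) % 2 - 1

/-- The gadget `g` with its strands at `i` and `j` replaced by the two parallel copies of `a`. -/
def inflate (g : ℕ → ℕ) (i j c m : ℕ) (a : ℕ → ℕ) (k : ℕ) : ℕ :=
  if k < i then blowUp c m 1 (g k)
  else if k < i + m then forwardStrand c a (k + 1 - i)
  else if k < j + m - 1 then blowUp c m 1 (g (k + 1 - m))
  else if k < j + 2 * m - 1 then backwardStrand c a (j + 2 * m - 1 - k)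
  else blowUp c m 1 (g (k + 2 - 2 * m))

theorem arcsCross_iff (p q r s : ℕ) : ArcsCross p q r s ↔
    (StrictlyBetween p q r ∧ ¬ StrictlyBetween p q s) ∨
      (StrictlyBetween p q s ∧ ¬ StrictlyBetween p q r) := Iff.rfl

theorem strictlyBetween_comm (p q x : ℕ) : StrictlyBetween p q x ↔ StrictlyBetween q p x := by
  rw [StrictlyBetween, StrictlyBetween, min_comm, max_comm]

theorem arcsCross_swap_left (p q r s : ℕ) : ArcsCross p q r s ↔ ArcsCross q p r s := by
  simp only [arcsCross_iff, strictlyBetween_comm p q]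

theorem arcsCross_swap_right (p q r s : ℕ) : ArcsCross p q r s ↔ ArcsCross p q s r := by
  simp only [arcsCross_iff, or_comm]

theorem arcsCross_congr {p q r s p' q' r' s' : ℕ} (h1 : p < r ↔ p' < r') (h2 : p < s ↔ p' < s')
    (h3 : q < r ↔ q' < r') (h4 : q < s ↔ q' < s') (h5 : r < p ↔ r' < p') (h6 : s < p ↔ s' < p')
    (h7 : r < q ↔ r' < q') (h8 : s < q ↔ s' < q') :
    ArcsCross p q r s ↔ ArcsCross p' q' r' s' := by
  simp only [arcsCross_iff, StrictlyBetween, min_lt_iff, lt_max_iff, h1, h2, h3, h4, h5, h6, h7, h8]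

theorem blowUp_strictMono {c m e : ℕ} (he : 1 ≤ e) (hem : e ≤ m) : StrictMono (blowUp c m e) := by
  intro u v h
  unfold blowUp
  split_ifs <;> omega

theorem strictlyBetween_map {f : ℕ → ℕ} (hf : StrictMono f) (p q x : ℕ) :
    StrictlyBetween (f p) (f q) (f x) ↔ StrictlyBetween p q x := by
  simp only [StrictlyBetween, ← hf.monotone.map_min, ← hf.monotone.map_max, hf.lt_iff_lt]

theorem arcsCross_map {f : ℕ → ℕ} (hf : StrictMono f) (p q r s : ℕ) :
    ArcsCross (f p) (f q) (f r) (f s) ↔ ArcsCross p q r s := by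
  simp only [ArcsCross, strictlyBetween_map hf]

theorem IsOpenMeandricPerm.not_arcsCross {n : ℕ} {a : ℕ → ℕ} (h : IsOpenMeandricPerm n a)
    {k l : ℕ} (hk : 1 ≤ k) (hkn : k < n) (hl : 1 ≤ l) (hln : l < n) (hkl : k % 2 = l % 2) :
    ¬ ArcsCross (a k) (a (k + 1)) (a l) (a (l + 1)) := by
  obtain ⟨-, -, -, -, hU, hD, -, -⟩ := h
  rcases Nat.even_or_odd k with hk' | hk'
  · exact hD k l hk' hk hkn (by rw [Nat.even_iff] at *; omega) hl hln
  · exact hU k l hk' hkn (by rw [Nat.odd_iff] at *; omega) hln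

/-- The end of an odd order meander that is visible from the side of arcs with index parity
that of `k`. -/
def visibleEnd (m : ℕ) (a : ℕ → ℕ) (k : ℕ) : ℕ := if k % 2 = 1 then a m else a 1

theorem IsOpenMeandricPerm.visibleEnd_mem {m : ℕ} {a : ℕ → ℕ} (h : IsOpenMeandricPerm m a) (k : ℕ) :
    1 ≤ visibleEnd m a k ∧ visibleEnd m a k ≤ m := by
  obtain ⟨h1, hr, -⟩ := h
  unfold visibleEnd
  split_ifs
  · exact hr m h1 le_rfl
  · exact hr 1 le_rfl h1

theorem IsOpenMeandricPerm.not_strictlyBetween_visibleEnd {m : ℕ} {a : ℕ → ℕ}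
    (h : IsOpenMeandricPerm m a) (hm : m % 2 = 1) {t : ℕ} (ht : 1 ≤ t) (htm : t < m) :
    ¬ StrictlyBetween (a t) (a (t + 1)) (visibleEnd m a t) := by
  obtain ⟨-, -, -, -, -, -, h1, h2⟩ := h
  rw [if_neg (by rw [Nat.even_iff]; omega)] at h2
  unfold visibleEnd
  split_ifs with h3
  · exact h2 t (Nat.odd_iff.2 h3) htm
  · exact h1 t (Nat.even_iff.2 (by omega)) ht htm

section Inflate

variable {N : ℕ} {g : ℕ → ℕ} {i j c m : ℕ} {a : ℕ → ℕ}

theorem IsGadget.one_le_c (hg : IsGadget N g i j c) : 1 ≤ c := by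
  have h1 := hg.perm.2.1 i hg.one_le (hg.lt.le.trans hg.le)
  rw [hg.left] at h1
  exact h1.1

theorem IsGadget.even_right (hg : IsGadget N g i j c) : j % 2 = 0 := by
  have h1 := hg.perm.2.2.2.1 i hg.one_le (hg.lt.le.trans hg.le)
  have h2 := hg.perm.2.2.2.1 j (hg.one_le.trans hg.lt.le) hg.le
  rw [hg.left] at h1
  rw [hg.right] at h2
  have := hg.odd
  omega

theorem IsGadget.add_three_le (hg : IsGadget N g i j c) : i + 3 ≤ j := by
  obtain ⟨k, h1, h2, h3⟩ := hg.low
  obtain ⟨l, h4, h5, h6⟩ := hg.high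
  have : k ≠ l := by rintro rfl; omega
  omega

theorem IsGadget.ne (hg : IsGadget N g i j c) {l : ℕ} (h1 : 1 ≤ l) (hN : l ≤ N) (hi : l ≠ i)
    (hj : l ≠ j) : g l ≠ c ∧ g l ≠ c + 1 := by
  have h3 := hg.perm.2.2.1
  have := hg.one_le
  have := hg.lt
  have := hg.le
  constructor
  · intro h
    exact hi (h3 l i h1 hN (by omega) (by omega) (by rw [h, hg.left]))
  · intro h
    exact hj (h3 l j h1 hN (by omega) (by omega) (by rw [h, hg.right]))

theorem blowUp_of_lt {e v : ℕ} (h : v < c) : blowUp c m e v = v := by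
  simp [blowUp, h]

theorem blowUp_of_gt {e v : ℕ} (h : c + 1 < v) : blowUp c m e v = v + 2 * m - 2 := by
  unfold blowUp
  split_ifs <;> omega

theorem blowUp_left (e : ℕ) : blowUp c m e c = c + 2 * e - 2 := by
  simp [blowUp]

theorem blowUp_right (e : ℕ) : blowUp c m e (c + 1) = c + 2 * e - 1 := by
  simp [blowUp]

theorem blowUp_congr {v : ℕ} (h : v ≠ c ∧ v ≠ c + 1) (e e' : ℕ) :
    blowUp c m e v = blowUp c m e' v := by
  unfold blowUp
  split_ifs <;> omega

/-- The place in the inflated curve of the place `l` of the gadget. -/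
def inflatePos (i j m l : ℕ) : ℕ :=
  if l < i then l else if l < j then l + m - 1 else l + 2 * m - 2

theorem inflate_forward {t : ℕ} (h1 : 1 ≤ t) (hm : t ≤ m) :
    inflate g i j c m a (i + t - 1) = forwardStrand c a t := by
  unfold inflate
  rw [if_neg (by omega), if_pos (by omega)]
  congr 1
  omega

theorem inflate_backward (hij : i < j) {t : ℕ} (h1 : 1 ≤ t) (hm : t ≤ m) :
    inflate g i j c m a (j + 2 * m - 1 - t) = backwardStrand c a t := by
  unfold inflate
  rw [if_neg (by omega), if_neg (by omega), if_neg (by omega), if_pos (by omega)]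
  congr 1
  omega

theorem inflate_pos (hij : i < j) (hm : 1 ≤ m) {l : ℕ} (hi : l ≠ i) (hj : l ≠ j) :
    inflate g i j c m a (inflatePos i j m l) = blowUp c m 1 (g l) := by
  unfold inflatePos
  split_ifs with h1 h2
  · simp [inflate, h1]
  · unfold inflate
    rw [if_neg (by omega), if_neg (by omega), if_pos (by omega)]
    congr 2
    omega
  · unfold inflate
    rw [if_neg (by omega), if_neg (by omega), if_neg (by omega), if_neg (by omega)]
    congr 2
    omega

theorem inflate_cases (hij : i < j) (hj : j ≤ N) (hm : 1 ≤ m) {k : ℕ} (h1 : 1 ≤ k)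
    (hk : k ≤ N + 2 * m - 2) :
    (∃ l, 1 ≤ l ∧ l ≤ N ∧ l ≠ i ∧ l ≠ j ∧ k = inflatePos i j m l) ∨
    (∃ t, 1 ≤ t ∧ t ≤ m ∧ k = i + t - 1) ∨ (∃ t, 1 ≤ t ∧ t ≤ m ∧ k = j + 2 * m - 1 - t) := by
  unfold inflatePos
  by_cases h2 : k < i
  · exact Or.inl ⟨k, by omega, by omega, by omega, by omega, by rw [if_pos h2]⟩
  by_cases h3 : k < i + m
  · exact Or.inr (Or.inl ⟨k + 1 - i, by omega, by omega, by omega⟩)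
  by_cases h4 : k < j + m - 1
  · exact Or.inl ⟨k + 1 - m, by omega, by omega, by omega, by omega,
      by rw [if_neg (by omega), if_pos (by omega)]; omega⟩
  by_cases h5 : k < j + 2 * m - 1
  · exact Or.inr (Or.inr ⟨j + 2 * m - 1 - k, by omega, by omega, by omega⟩)
  · exact Or.inl ⟨k + 2 - 2 * m, by omega, by omega, by omega, by omega,
      by rw [if_neg (by omega), if_neg (by omega)]; omega⟩

theorem IsGadget.inflate_outer (hg : IsGadget N g i j c) (hm : 1 ≤ m) (a : ℕ → ℕ) {l : ℕ}
    (h1 : 1 ≤ l) (hN : l ≤ N) (hi : l ≠ i) (hj : l ≠ j) :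
    (g l < c ∧ inflate g i j c m a (inflatePos i j m l) = g l) ∨
    (c + 1 < g l ∧ inflate g i j c m a (inflatePos i j m l) = g l + 2 * m - 2) := by
  rw [inflate_pos hg.lt hm hi hj]
  have := hg.ne h1 hN hi hj
  rcases lt_or_gt_of_ne this.1 with h | h
  · exact Or.inl ⟨h, blowUp_of_lt h⟩
  · exact Or.inr ⟨by omega, blowUp_of_gt (by omega)⟩

theorem IsOpenMeandricPerm.strand_mem (ha : IsOpenMeandricPerm m a) {t : ℕ} (h1 : 1 ≤ t)
    (hm : t ≤ m) : 1 ≤ a t ∧ a t ≤ m ∧ a t % 2 = t % 2 :=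
  ⟨(ha.2.1 t h1 hm).1, (ha.2.1 t h1 hm).2, ha.2.2.2.1 t h1 hm⟩

/-- An arc of the inflated curve comes from an arc of the gadget or from one of the two copies of
an arc of `a`. -/
theorem IsGadget.inflate_arc_cases (hg : IsGadget N g i j c) (a : ℕ → ℕ)
    (hm : m % 2 = 1) {k : ℕ} (h1 : 1 ≤ k) (hk : k < N + 2 * m - 2) :
    (∃ l, 1 ≤ l ∧ l < N ∧ l % 2 = k % 2 ∧
      inflate g i j c m a k = blowUp c m (visibleEnd m a k) (g l) ∧
      inflate g i j c m a (k + 1) = blowUp c m (visibleEnd m a k) (g (l + 1))) ∨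
    (∃ t, 1 ≤ t ∧ t < m ∧ t % 2 = k % 2 ∧
      inflate g i j c m a k = forwardStrand c a t ∧
      inflate g i j c m a (k + 1) = forwardStrand c a (t + 1)) ∨
    (∃ t, 1 ≤ t ∧ t < m ∧ t % 2 = k % 2 ∧
      inflate g i j c m a k = backwardStrand c a (t + 1) ∧
      inflate g i j c m a (k + 1) = backwardStrand c a t) := by
  have hi1 := hg.one_le
  have hlt := hg.add_three_le
  have hle := hg.le
  have hio := hg.odd
  have hje := hg.even_right
  have hc := hg.one_le_c
  have outer : ∀ k' l, 1 ≤ l → l ≤ N → l ≠ i → l ≠ j → k' = inflatePos i j m l →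
      inflate g i j c m a k' = blowUp c m (visibleEnd m a k) (g l) := by
    intro k' l hl hlN hli hlj hk'
    rw [hk', inflate_pos (by omega) (by omega) hli hlj]
    exact blowUp_congr (hg.ne hl hlN hli hlj) _ _
  have inner1 : ∀ k' t, 1 ≤ t → t ≤ m → a t = visibleEnd m a k → t % 2 = 1 → k' = i + t - 1 →
      inflate g i j c m a k' = blowUp c m (visibleEnd m a k) (g i) := by
    intro k' t ht htm hte ht2 hk'
    rw [hk', inflate_forward ht htm, hg.left, blowUp_left, ← hte, forwardStrand]
    omega
  have inner2 : ∀ k' t, 1 ≤ t → t ≤ m → a t = visibleEnd m a k → t % 2 = 1 →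
      k' = j + 2 * m - 1 - t →
      inflate g i j c m a k' = blowUp c m (visibleEnd m a k) (g j) := by
    intro k' t ht htm hte ht2 hk'
    rw [hk', inflate_backward (by omega) ht htm, hg.right, blowUp_right, ← hte, backwardStrand]
    omega
  have pos1 : ∀ l, l < i → l = inflatePos i j m l := by
    intro l hl; simp [inflatePos, hl]
  have pos2 : ∀ k' l, i < l → l < j → k' + 1 = l + m → k' = inflatePos i j m l := by
    intro k' l hl hl' h; unfold inflatePos; rw [if_neg (by omega), if_pos (by omega)]; omega
  have pos3 : ∀ k' l, j < l → k' + 2 = l + 2 * m → k' = inflatePos i j m l := by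
    intro k' l hl h; unfold inflatePos; rw [if_neg (by omega), if_neg (by omega)]; omega
  have e0 : k % 2 = 0 → a 1 = visibleEnd m a k := by
    intro h; simp [visibleEnd, h]
  have e1 : k % 2 = 1 → a m = visibleEnd m a k := by
    intro h; simp [visibleEnd, h]
  by_cases h2 : k + 1 < i
  · exact Or.inl ⟨k, by omega, by omega, by omega,
      outer k k (by omega) (by omega) (by omega) (by omega) (pos1 _ (by omega)),
      outer _ _ (by omega) (by omega) (by omega) (by omega) (pos1 _ (by omega))⟩
  by_cases h3 : k + 1 = i
  · refine Or.inl ⟨k, by omega, by omega, by omega,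
      outer k k (by omega) (by omega) (by omega) (by omega) (pos1 _ (by omega)), ?_⟩
    rw [h3]
    exact inner1 i 1 (by omega) (by omega) (e0 (by omega)) (by omega) (by omega)
  by_cases h4 : k + 1 < i + m
  · refine Or.inr (Or.inl ⟨k + 1 - i, by omega, by omega, by omega, ?_, ?_⟩)
    · rw [← inflate_forward (g := g) (i := i) (j := j) (m := m) (by omega) (by omega)]
      congr 1
      omega
    · rw [← inflate_forward (g := g) (i := i) (j := j) (m := m) (by omega) (by omega)]
      congr 1
      omega
  by_cases h5 : k + 1 = i + m
  · exact Or.inl ⟨i, by omega, by omega, by omega,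
      inner1 k m (by omega) (by omega) (e1 (by omega)) (by omega) (by omega),
      outer _ _ (by omega) (by omega) (by omega) (by omega)
        (pos2 _ _ (by omega) (by omega) (by omega))⟩
  by_cases h6 : k + 1 < j + m - 1
  · exact Or.inl ⟨k + 1 - m, by omega, by omega, by omega,
      outer _ _ (by omega) (by omega) (by omega) (by omega)
        (pos2 _ _ (by omega) (by omega) (by omega)),
      outer _ _ (by omega) (by omega) (by omega) (by omega)
        (pos2 _ _ (by omega) (by omega) (by omega))⟩
  by_cases h7 : k + 1 = j + m - 1
  · refine Or.inl ⟨j - 1, by omega, by omega, by omega,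
      outer _ _ (by omega) (by omega) (by omega) (by omega)
        (pos2 _ _ (by omega) (by omega) (by omega)), ?_⟩
    rw [Nat.sub_add_cancel (by omega)]
    exact inner2 _ m (by omega) (by omega) (e1 (by omega)) (by omega) (by omega)
  by_cases h8 : k + 1 < j + 2 * m - 1
  · refine Or.inr (Or.inr ⟨j + 2 * m - 2 - k, by omega, by omega, by omega, ?_, ?_⟩)
    · rw [← inflate_backward (g := g) (i := i) (j := j) (m := m) (by omega) (by omega) (by omega)]
      congr 1
      omega
    · rw [← inflate_backward (g := g) (i := i) (j := j) (m := m) (by omega) (by omega) (by omega)]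
      congr 1
      omega
  by_cases h9 : k + 1 = j + 2 * m - 1
  · exact Or.inl ⟨j, by omega, by omega, by omega,
      inner2 _ 1 (by omega) (by omega) (e0 (by omega)) (by omega) (by omega),
      outer _ _ (by omega) (by omega) (by omega) (by omega)
        (pos3 _ _ (by omega) (by omega))⟩
  · exact Or.inl ⟨k + 2 - 2 * m, by omega, by omega, by omega,
      outer _ _ (by omega) (by omega) (by omega) (by omega)
        (pos3 _ _ (by omega) (by omega)),
      outer _ _ (by omega) (by omega) (by omega) (by omega)
        (pos3 _ _ (by omega) (by omega))⟩

/-- The values `p`, `q` are the ends of one of the two copies of an arc of `a` of index `t`. -/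
def IsStrandArc (c : ℕ) (a : ℕ → ℕ) (t p q : ℕ) : Prop :=
  (p = forwardStrand c a t ∧ q = forwardStrand c a (t + 1)) ∨
  (p = backwardStrand c a (t + 1) ∧ q = backwardStrand c a t)

theorem IsStrandArc.blowUp_lt_or_lt (ha : IsOpenMeandricPerm m a) (hm : m % 2 = 1)
    (hc : 1 ≤ c) {t p q k : ℕ} (h1 : 1 ≤ t) (htm : t < m) (hk : t % 2 = k % 2)
    (h : IsStrandArc c a t p q) (v : ℕ) :
    blowUp c m (visibleEnd m a k) v < min p q ∨ max p q < blowUp c m (visibleEnd m a k) v := by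
  have he : visibleEnd m a k = visibleEnd m a t := by simp [visibleEnd, hk]
  rw [he]
  have hv := ha.not_strictlyBetween_visibleEnd hm h1 htm
  have hne : visibleEnd m a t ≠ a t ∧ visibleEnd m a t ≠ a (t + 1) := by
    have hinj := ha.2.2.1
    unfold visibleEnd
    split_ifs
    · constructor
      · intro h'
        have := hinj m t (by omega) (by omega) (by omega) (by omega) h'
        omega
      · intro h'
        have := hinj m (t + 1) (by omega) (by omega) (by omega) (by omega) h'
        omega
    · constructor
      · intro h'
        have := hinj 1 t (by omega) (by omega) (by omega) (by omega) h'
        omega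
      · intro h'
        have := hinj 1 (t + 1) (by omega) (by omega) (by omega) (by omega) h'
        omega
  have h2 := ha.strand_mem h1 htm.le
  have h3 := ha.strand_mem (t := t + 1) (by omega) htm
  have h4 := ha.visibleEnd_mem t
  generalize visibleEnd m a t = e at *
  simp only [IsStrandArc, forwardStrand, backwardStrand] at h
  simp only [StrictlyBetween] at hv
  unfold blowUp
  split_ifs <;> omega

/-- The value `p` is one of the two copies of `x`. -/
def IsCopy (c p x : ℕ) : Prop := p + 1 = c + 2 * x ∨ p + 2 = c + 2 * x

theorem IsCopy.lt_iff {p r x y : ℕ} (hp : IsCopy c p x) (hr : IsCopy c r y) (h : x ≠ y) :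
    p < r ↔ x < y := by
  unfold IsCopy at hp hr
  omega

theorem IsCopy.arcsCross_iff {p q r s x y z w : ℕ} (hp : IsCopy c p x) (hq : IsCopy c q y)
    (hr : IsCopy c r z) (hs : IsCopy c s w) (hxz : x ≠ z) (hxw : x ≠ w) (hyz : y ≠ z)
    (hyw : y ≠ w) : ArcsCross p q r s ↔ ArcsCross x y z w :=
  arcsCross_congr (hp.lt_iff hr hxz) (hp.lt_iff hs hxw) (hq.lt_iff hr hyz) (hq.lt_iff hs hyw)
    (hr.lt_iff hp hxz.symm) (hs.lt_iff hp hxw.symm) (hr.lt_iff hq hyz.symm)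
    (hs.lt_iff hq hyw.symm)

theorem IsOpenMeandricPerm.isCopy_forwardStrand (ha : IsOpenMeandricPerm m a) (c : ℕ) {t : ℕ}
    (h1 : 1 ≤ t) (hm : t ≤ m) : IsCopy c (forwardStrand c a t) (a t) := by
  have := ha.strand_mem h1 hm
  unfold forwardStrand IsCopy
  omega

theorem IsOpenMeandricPerm.isCopy_backwardStrand (ha : IsOpenMeandricPerm m a) (c : ℕ) {t : ℕ}
    (h1 : 1 ≤ t) (hm : t ≤ m) : IsCopy c (backwardStrand c a t) (a t) := by
  have := ha.strand_mem h1 hm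
  unfold backwardStrand IsCopy
  omega

theorem IsStrandArc.not_arcsCross (ha : IsOpenMeandricPerm m a) (hc : 1 ≤ c)
    {t s p q r u : ℕ} (h1 : 1 ≤ t) (htm : t < m) (hs1 : 1 ≤ s) (hsm : s < m)
    (hts : t % 2 = s % 2) (h : IsStrandArc c a t p q) (h' : IsStrandArc c a s r u) :
    ¬ ArcsCross p q r u := by
  have h2 := ha.strand_mem h1 htm.le
  have h3 := ha.strand_mem (t := t + 1) (by omega) htm
  have h4 := ha.strand_mem hs1 hsm.le
  have h5 := ha.strand_mem (t := s + 1) (by omega) hsm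
  by_cases hst : s = t
  · subst hst
    simp only [IsStrandArc, forwardStrand, backwardStrand] at h h'
    simp only [arcsCross_iff, StrictlyBetween]
    omega
  · have h6 := ha.not_arcsCross h1 htm hs1 hsm hts
    have hinj := ha.2.2.1
    have h7 : a t ≠ a s := fun e ↦ by
      have := hinj _ _ (by omega) (by omega) (by omega) (by omega) e
      omega
    have h8 : a (t + 1) ≠ a (s + 1) := fun e ↦ by
      have := hinj _ _ (by omega) (by omega) (by omega) (by omega) e
      omega
    have h9 : a t ≠ a (s + 1) := by omega
    have h10 : a (t + 1) ≠ a s := by omega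
    have ft := ha.isCopy_forwardStrand c h1 htm.le
    have ft' := ha.isCopy_forwardStrand c (t := t + 1) (by omega) htm
    have fs := ha.isCopy_forwardStrand c hs1 hsm.le
    have fs' := ha.isCopy_forwardStrand c (t := s + 1) (by omega) hsm
    have bt := ha.isCopy_backwardStrand c h1 htm.le
    have bt' := ha.isCopy_backwardStrand c (t := t + 1) (by omega) htm
    have bs := ha.isCopy_backwardStrand c hs1 hsm.le
    have bs' := ha.isCopy_backwardStrand c (t := s + 1) (by omega) hsm
    rcases h with ⟨rfl, rfl⟩ | ⟨rfl, rfl⟩ <;> rcases h' with ⟨rfl, rfl⟩ | ⟨rfl, rfl⟩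
    · rwa [ft.arcsCross_iff ft' fs fs' h7 h9 h10 h8]
    · rwa [arcsCross_swap_right, ft.arcsCross_iff ft' bs bs' h7 h9 h10 h8]
    · rwa [arcsCross_swap_left, bt.arcsCross_iff bt' fs fs' h7 h9 h10 h8]
    · rwa [arcsCross_swap_left, arcsCross_swap_right, bt.arcsCross_iff bt' bs bs' h7 h9 h10 h8]

theorem IsGadget.inflate_arc_cases' (hg : IsGadget N g i j c) (a : ℕ → ℕ)
    (hm : m % 2 = 1) {k : ℕ} (h1 : 1 ≤ k) (hk : k < N + 2 * m - 2) :
    (∃ l, 1 ≤ l ∧ l < N ∧ l % 2 = k % 2 ∧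
      inflate g i j c m a k = blowUp c m (visibleEnd m a k) (g l) ∧
      inflate g i j c m a (k + 1) = blowUp c m (visibleEnd m a k) (g (l + 1))) ∨
    (∃ t, 1 ≤ t ∧ t < m ∧ t % 2 = k % 2 ∧
      IsStrandArc c a t (inflate g i j c m a k) (inflate g i j c m a (k + 1))) := by
  rcases hg.inflate_arc_cases a hm h1 hk with h | ⟨t, h1, h2, h3, h4⟩ | ⟨t, h1, h2, h3, h4⟩
  · exact Or.inl h
  · exact Or.inr ⟨t, h1, h2, h3, Or.inl h4⟩
  · exact Or.inr ⟨t, h1, h2, h3, Or.inr h4⟩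

theorem IsGadget.inflate_not_arcsCross (hg : IsGadget N g i j c) (ha : IsOpenMeandricPerm m a)
    (hm : m % 2 = 1) {k l : ℕ} (hk1 : 1 ≤ k) (hk : k < N + 2 * m - 2) (hl1 : 1 ≤ l)
    (hl : l < N + 2 * m - 2) (hkl : k % 2 = l % 2) :
    ¬ ArcsCross (inflate g i j c m a k) (inflate g i j c m a (k + 1))
      (inflate g i j c m a l) (inflate g i j c m a (l + 1)) := by
  have hc := hg.one_le_c
  have he : visibleEnd m a k = visibleEnd m a l := by simp [visibleEnd, hkl]
  have hmono : StrictMono (blowUp c m (visibleEnd m a l)) :=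
    blowUp_strictMono (ha.visibleEnd_mem l).1 (ha.visibleEnd_mem l).2
  rcases hg.inflate_arc_cases' a hm hk1 hk with ⟨x, hx1, hxN, hx2, hx, hx'⟩ | ⟨t, ht1, htm, ht2, ht⟩
  · rcases hg.inflate_arc_cases' a hm hl1 hl with ⟨y, hy1, hyN, hy2, hy, hy'⟩ | ⟨s, hs1, hsm, hs2, hs⟩
    · rw [hx, hx', hy, hy', he, arcsCross_map hmono]
      exact hg.perm.not_arcsCross hx1 hxN hy1 hyN (by omega)
    · have h1 := hs.blowUp_lt_or_lt ha hm hc hs1 hsm hs2 (g x)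
      have h2 := hs.blowUp_lt_or_lt ha hm hc hs1 hsm hs2 (g (x + 1))
      rw [← he, ← hx] at h1
      rw [← he, ← hx'] at h2
      simp only [arcsCross_iff, StrictlyBetween]
      omega
  · rcases hg.inflate_arc_cases' a hm hl1 hl with ⟨y, hy1, hyN, hy2, hy, hy'⟩ | ⟨s, hs1, hsm, hs2, hs⟩
    · have h1 := ht.blowUp_lt_or_lt ha hm hc ht1 htm ht2 (g y)
      have h2 := ht.blowUp_lt_or_lt ha hm hc ht1 htm ht2 (g (y + 1))
      rw [he, ← hy] at h1
      rw [he, ← hy'] at h2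
      simp only [arcsCross_iff, StrictlyBetween]
      omega
    · exact IsStrandArc.not_arcsCross ha hc ht1 htm hs1 hsm (by omega) ht hs

/-- No arc of the inflated curve encloses a blown-up value not enclosed by the arcs of the gadget
on the same side. -/
theorem IsGadget.inflate_not_strictlyBetween (hg : IsGadget N g i j c)
    (ha : IsOpenMeandricPerm m a) (hm : m % 2 = 1) {v : ℕ} {k : ℕ} (hk1 : 1 ≤ k)
    (hk : k < N + 2 * m - 2)
    (hv : ∀ l, 1 ≤ l → l < N → l % 2 = k % 2 → ¬ StrictlyBetween (g l) (g (l + 1)) v) :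
    ¬ StrictlyBetween (inflate g i j c m a k) (inflate g i j c m a (k + 1))
      (blowUp c m (visibleEnd m a k) v) := by
  rcases hg.inflate_arc_cases' a hm hk1 hk with ⟨x, hx1, hxN, hx2, hx, hx'⟩ | ⟨t, ht1, htm, ht2, ht⟩
  · rw [hx, hx', strictlyBetween_map
      (blowUp_strictMono (ha.visibleEnd_mem k).1 (ha.visibleEnd_mem k).2)]
    exact hv x hx1 hxN hx2
  · have h1 := ht.blowUp_lt_or_lt ha hm hg.one_le_c ht1 htm ht2 v
    simp only [StrictlyBetween]
    omega

/-- A value of the inflated curve lies among the values `c, …, c + 2 m - 1` replacing `c`, `c + 1`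
exactly on the two strands, and its residue modulo four tells these apart. -/
theorem IsOpenMeandricPerm.forwardStrand_mem (ha : IsOpenMeandricPerm m a) (hc : c % 2 = 1)
    {t : ℕ} (h1 : 1 ≤ t) (hm : t ≤ m) :
    c ≤ forwardStrand c a t ∧ forwardStrand c a t + 1 ≤ c + 2 * m ∧
      forwardStrand c a t % 2 = t % 2 ∧ forwardStrand c a t + 1 + t % 2 = c + 2 * a t ∧
      ((forwardStrand c a t + 1 - c) % 4 = 0 ∨ (forwardStrand c a t + 1 - c) % 4 = 1) := by
  have := ha.strand_mem h1 hm
  unfold forwardStrand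
  omega

theorem IsOpenMeandricPerm.backwardStrand_mem (ha : IsOpenMeandricPerm m a) (hc : c % 2 = 1)
    {t : ℕ} (h1 : 1 ≤ t) (hm : t ≤ m) :
    c ≤ backwardStrand c a t ∧ backwardStrand c a t + 1 ≤ c + 2 * m ∧
      backwardStrand c a t % 2 = (t + 1) % 2 ∧
      backwardStrand c a t + 1 + (t + 1) % 2 = c + 2 * a t ∧
      ((backwardStrand c a t + 1 - c) % 4 = 2 ∨ (backwardStrand c a t + 1 - c) % 4 = 3) := by
  have := ha.strand_mem h1 hm
  unfold backwardStrand
  omega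

theorem IsGadget.odd_c (hg : IsGadget N g i j c) : c % 2 = 1 := by
  have h1 := hg.perm.2.2.2.1 i hg.one_le (hg.lt.le.trans hg.le)
  rw [hg.left, hg.odd] at h1
  exact h1

theorem inflatePos_mod_two (hm : m % 2 = 1) (l : ℕ) : inflatePos i j m l % 2 = l % 2 := by
  unfold inflatePos
  split_ifs <;> omega

theorem IsGadget.inflate_injOn (hg : IsGadget N g i j c) (ha : IsOpenMeandricPerm m a)
    (hm : m % 2 = 1) {k l : ℕ} (hk1 : 1 ≤ k) (hk : k ≤ N + 2 * m - 2) (hl1 : 1 ≤ l)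
    (hl : l ≤ N + 2 * m - 2) (h : inflate g i j c m a k = inflate g i j c m a l) : k = l := by
  have hc := hg.odd_c
  have hinj := hg.perm.2.2.1
  have hinja := ha.2.2.1
  rcases inflate_cases (m := m) hg.lt hg.le (by omega) hk1 hk with
    ⟨x, hx1, hxN, hxi, hxj, hx⟩ | ⟨t, ht1, htm, ht⟩ | ⟨t, ht1, htm, ht⟩ <;>
  rcases inflate_cases (m := m) hg.lt hg.le (by omega) hl1 hl with
    ⟨y, hy1, hyN, hyi, hyj, hy⟩ | ⟨s, hs1, hsm, hs⟩ | ⟨s, hs1, hsm, hs⟩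
  · have h1 := hg.inflate_outer (m := m) (by omega) a hx1 hxN hxi hxj
    have h2 := hg.inflate_outer (m := m) (by omega) a hy1 hyN hyi hyj
    rw [← hx] at h1
    rw [← hy] at h2
    have := hinj x y hx1 hxN hy1 hyN (by omega)
    rw [hx, hy, this]
  · have h1 := hg.inflate_outer (m := m) (by omega) a hx1 hxN hxi hxj
    have h2 := ha.forwardStrand_mem hc hs1 hsm
    rw [← inflate_forward (g := g) (i := i) (j := j) hs1 hsm, ← hs] at h2
    rw [← hx] at h1
    omega
  · have h1 := hg.inflate_outer (m := m) (by omega) a hx1 hxN hxi hxj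
    have h2 := ha.backwardStrand_mem hc hs1 hsm
    rw [← inflate_backward (g := g) hg.lt hs1 hsm, ← hs] at h2
    rw [← hx] at h1
    omega
  · have h1 := hg.inflate_outer (m := m) (by omega) a hy1 hyN hyi hyj
    have h2 := ha.forwardStrand_mem hc ht1 htm
    rw [← inflate_forward (g := g) (i := i) (j := j) ht1 htm, ← ht] at h2
    rw [← hy] at h1
    omega
  · have h1 := ha.forwardStrand_mem hc hs1 hsm
    have h2 := ha.forwardStrand_mem hc ht1 htm
    rw [← inflate_forward (g := g) (i := i) (j := j) ht1 htm, ← ht] at h2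
    rw [← inflate_forward (g := g) (i := i) (j := j) hs1 hsm, ← hs] at h1
    have := hinja t s ht1 htm hs1 hsm (by omega)
    omega
  · have h1 := ha.backwardStrand_mem hc hs1 hsm
    have h2 := ha.forwardStrand_mem hc ht1 htm
    rw [← inflate_forward (g := g) (i := i) (j := j) ht1 htm, ← ht] at h2
    rw [← inflate_backward (g := g) hg.lt hs1 hsm, ← hs] at h1
    omega
  · have h1 := hg.inflate_outer (m := m) (by omega) a hy1 hyN hyi hyj
    have h2 := ha.backwardStrand_mem hc ht1 htm
    rw [← inflate_backward (g := g) hg.lt ht1 htm, ← ht] at h2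
    rw [← hy] at h1
    omega
  · have h1 := ha.forwardStrand_mem hc hs1 hsm
    have h2 := ha.backwardStrand_mem hc ht1 htm
    rw [← inflate_backward (g := g) hg.lt ht1 htm, ← ht] at h2
    rw [← inflate_forward (g := g) (i := i) (j := j) hs1 hsm, ← hs] at h1
    omega
  · have h1 := ha.backwardStrand_mem hc hs1 hsm
    have h2 := ha.backwardStrand_mem hc ht1 htm
    rw [← inflate_backward (g := g) hg.lt ht1 htm, ← ht] at h2
    rw [← inflate_backward (g := g) hg.lt hs1 hsm, ← hs] at h1
    have := hinja t s ht1 htm hs1 hsm (by omega)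
    omega

theorem IsGadget.inflate_isOpenMeandricPerm (hg : IsGadget N g i j c)
    (ha : IsOpenMeandricPerm m a) (hm : m % 2 = 1) :
    IsOpenMeandricPerm (N + 2 * m - 2) (inflate g i j c m a) := by
  have hc := hg.odd_c
  have hi := hg.one_le
  have hij := hg.lt
  have hjN := hg.le
  have hi2 := hg.odd
  have hj2 := hg.even_right
  have hfirst : ∀ k, k % 2 = 0 →
      inflate g i j c m a 1 = blowUp c m (visibleEnd m a k) (g 1) := by
    intro k hk
    rcases hi.eq_or_lt with h | h
    · subst h
      have := inflate_forward (g := g) (i := 1) (j := j) (c := c) (m := m) (a := a) le_rfl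
        (show 1 ≤ m by omega)
      rw [show 1 + 1 - 1 = 1 from rfl] at this
      rw [this, hg.left, blowUp_left, visibleEnd, if_neg (by omega), forwardStrand]
      omega
    · have := inflate_pos (g := g) (c := c) (a := a) hij (show 1 ≤ m by omega)
        (show 1 ≠ i by omega) (show 1 ≠ j by omega)
      rw [inflatePos, if_pos h] at this
      rw [this]
      exact blowUp_congr (hg.ne le_rfl (by omega) (by omega) (by omega)) _ _
  have hlast : ∀ k, k % 2 = N % 2 →
      inflate g i j c m a (N + 2 * m - 2) = blowUp c m (visibleEnd m a k) (g N) := by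
    intro k hk
    rcases hjN.eq_or_lt with h | h
    · subst h
      have := inflate_backward (g := g) (c := c) (a := a) hij le_rfl (show 1 ≤ m by omega)
      rw [show j + 2 * m - 1 - 1 = j + 2 * m - 2 by omega] at this
      rw [this, hg.right, blowUp_right, visibleEnd, if_neg (by omega), backwardStrand]
      omega
    · have := inflate_pos (g := g) (c := c) (a := a) hij (show 1 ≤ m by omega)
        (show N ≠ i by omega) (show N ≠ j by omega)
      rw [inflatePos, if_neg (by omega), if_neg (by omega)] at this
      rw [this]
      exact blowUp_congr (hg.ne (by omega) (by omega) (by omega) (by omega)) _ _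
  obtain ⟨-, hr, -, hp, -, -, hR1, hR2⟩ := hg.perm
  refine ⟨by omega, ?_, ?_, ?_, ?_, ?_, ?_, ?_⟩
  · intro k hk1 hk
    rcases inflate_cases (m := m) hg.lt hg.le (by omega) hk1 hk with
      ⟨x, hx1, hxN, hxi, hxj, hx⟩ | ⟨t, ht1, htm, ht⟩ | ⟨t, ht1, htm, ht⟩
    · have h1 := hg.inflate_outer (m := m) (by omega) a hx1 hxN hxi hxj
      have h2 := hr x hx1 hxN
      rw [← hx] at h1
      have := hr i (by omega) (by omega)
      have := hr j (by omega) (by omega)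
      rw [hg.left] at *
      rw [hg.right] at *
      omega
    · rw [ht, inflate_forward ht1 htm]
      have := ha.forwardStrand_mem hc ht1 htm
      have := hr j (by omega) (by omega)
      rw [hg.right] at *
      omega
    · rw [ht, inflate_backward hij ht1 htm]
      have := ha.backwardStrand_mem hc ht1 htm
      have := hr j (by omega) (by omega)
      rw [hg.right] at *
      omega
  · intro k l hk1 hk hl1 hl h
    exact hg.inflate_injOn ha hm hk1 hk hl1 hl h
  · intro k hk1 hk
    rcases inflate_cases (m := m) hg.lt hg.le (by omega) hk1 hk with
      ⟨x, hx1, hxN, hxi, hxj, hx⟩ | ⟨t, ht1, htm, ht⟩ | ⟨t, ht1, htm, ht⟩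
    · have h1 := hg.inflate_outer (m := m) (by omega) a hx1 hxN hxi hxj
      have h2 := hp x hx1 hxN
      have h3 := inflatePos_mod_two (i := i) (j := j) hm x
      rw [← hx] at h1 h3
      omega
    · rw [ht, inflate_forward ht1 htm]
      have := ha.forwardStrand_mem hc ht1 htm
      omega
    · rw [ht, inflate_backward hij ht1 htm]
      have := ha.backwardStrand_mem hc ht1 htm
      omega
  · intro k l hk2 hk hl2 hl
    rw [Nat.odd_iff] at hk2 hl2
    exact hg.inflate_not_arcsCross ha hm (by omega) hk (by omega) hl (by omega)
  · intro k l hk2 hk1 hk hl2 hl1 hl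
    rw [Nat.even_iff] at hk2 hl2
    exact hg.inflate_not_arcsCross ha hm hk1 hk hl1 hl (by omega)
  · intro k hk2 hk1 hk
    rw [Nat.even_iff] at hk2
    rw [hfirst k hk2]
    exact hg.inflate_not_strictlyBetween ha hm hk1 hk fun l h1 h2 h3 ↦
      hR1 l (Nat.even_iff.2 (by omega)) h1 h2
  · split_ifs at hR2 ⊢ with hN hn hn
    · intro k hk2 hk1 hk
      rw [Nat.even_iff] at *
      rw [hlast k (by omega)]
      exact hg.inflate_not_strictlyBetween ha hm hk1 hk fun l h1 h2 h3 ↦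
        hR2 l (Nat.even_iff.2 (by omega)) h1 h2
    · rw [Nat.even_iff] at *
      omega
    · rw [Nat.even_iff] at *
      omega
    · intro k hk2 hk
      rw [Nat.even_iff] at *
      rw [Nat.odd_iff] at *
      rw [hlast k (by omega)]
      exact hg.inflate_not_strictlyBetween ha hm (by omega) hk fun l h1 h2 h3 ↦
        hR2 l (Nat.odd_iff.2 (by omega)) h2

end Inflate

section InflateSimple

variable {N : ℕ} {g : ℕ → ℕ} {i j c m : ℕ} {a : ℕ → ℕ}

theorem IsGadget.not_interval (hg : IsGadget N g i j c) {k₁ k₂ lo d : ℕ} (h1 : 1 ≤ k₁)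
    (hN : k₂ ≤ N) (h3 : k₁ + 3 ≤ k₂) (hd : k₂ = k₁ + d) (hne : ¬ (k₁ = 1 ∧ k₂ = N))
    (h : ∀ k, k₁ ≤ k → k ≤ k₂ → lo ≤ g k ∧ g k ≤ lo + d) : False := by
  obtain ⟨k, l, hk, hk', hl, hl', hkl⟩ := hg.simple k₁ k₂ h1 hN h3 hne
  have := h k hk hk'
  have := h l hl hl'
  omega

theorem IsGadget.inflate_of_lt (hg : IsGadget N g i j c) (hm : 1 ≤ m) (a : ℕ → ℕ) {k : ℕ}
    (h1 : 1 ≤ k) (hk : k < i) :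
    (g k < c ∧ inflate g i j c m a k = g k) ∨
    (c + 1 < g k ∧ inflate g i j c m a k = g k + 2 * m - 2) := by
  have := hg.lt
  have := hg.le
  have h := hg.inflate_outer hm a h1 (by omega) (by omega) (by omega)
  rwa [inflatePos, if_pos hk] at h

theorem IsGadget.inflate_of_between (hg : IsGadget N g i j c) (hm : 1 ≤ m) (a : ℕ → ℕ) {k : ℕ}
    (hi : i < k) (hk : k < j) :
    (g k < c ∧ inflate g i j c m a (k + m - 1) = g k) ∨
    (c + 1 < g k ∧ inflate g i j c m a (k + m - 1) = g k + 2 * m - 2) := by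
  have := hg.one_le
  have := hg.le
  have h := hg.inflate_outer hm a (l := k) (by omega) (by omega) (by omega) (by omega)
  rwa [inflatePos, if_neg (by omega), if_pos hk] at h

theorem IsGadget.inflate_of_gt (hg : IsGadget N g i j c) (hm : 1 ≤ m) (a : ℕ → ℕ) {k : ℕ}
    (hj : j < k) (hk : k ≤ N) :
    (g k < c ∧ inflate g i j c m a (k + 2 * m - 2) = g k) ∨
    (c + 1 < g k ∧ inflate g i j c m a (k + 2 * m - 2) = g k + 2 * m - 2) := by
  have := hg.one_le
  have := hg.lt
  have h := hg.inflate_outer hm a (l := k) (by omega) (by omega) (by omega) (by omega)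
  rwa [inflatePos, if_neg (by omega), if_neg (by omega)] at h

/-- The inflated curve has no proper window of length at least four filling an interval. -/
theorem IsGadget.inflate_simple (hg : IsGadget N g i j c) (ha : IsOpenMeandricPerm m a)
    (hm : m % 2 = 1) (hm3 : 3 ≤ m) {k₁ k₂ lo d : ℕ} (h1 : 1 ≤ k₁) (hn : k₂ ≤ N + 2 * m - 2)
    (h3 : 3 ≤ d) (hd : k₂ = k₁ + d) (hne : ¬ (k₁ = 1 ∧ k₂ = N + 2 * m - 2))
    (h : ∀ k, k₁ ≤ k → k ≤ k₂ → lo ≤ inflate g i j c m a k ∧ inflate g i j c m a k ≤ lo + d)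
    (hsurj : ∀ v, lo ≤ v → v ≤ lo + d → ∃ k, k₁ ≤ k ∧ k ≤ k₂ ∧ inflate g i j c m a k = v) :
    False := by
  have hc := hg.odd_c
  have hi := hg.one_le
  have hij := hg.lt
  have hjN := hg.le
  have hm1 : 1 ≤ m := by omega
  -- values on the strands
  have hout : ∀ k, 1 ≤ k → k ≤ N + 2 * m - 2 → k < i ∨ (i + m ≤ k ∧ k + 1 < j + m) ∨
      j + 2 * m ≤ k + 1 → inflate g i j c m a k < c ∨ c + 2 * m ≤ inflate g i j c m a k := by
    intro k hk1 hk hk'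
    rcases hk' with hk' | ⟨hk', hk''⟩ | hk'
    · have := hg.inflate_of_lt hm1 a hk1 hk'
      omega
    · have := hg.inflate_of_between hm1 a (k := k + 1 - m) (by omega) (by omega)
      rw [show k + 1 - m + m - 1 = k by omega] at this
      omega
    · have := hg.inflate_of_gt hm1 a (k := k + 2 - 2 * m) (by omega) (by omega)
      rw [show k + 2 - 2 * m + 2 * m - 2 = k by omega] at this
      omega
  have hfw : ∀ k, i ≤ k → k < i + m → c ≤ inflate g i j c m a k ∧
      inflate g i j c m a k < c + 2 * m ∧ ((inflate g i j c m a k + 1 - c) % 4 = 0 ∨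
        (inflate g i j c m a k + 1 - c) % 4 = 1) := by
    intro k hk hk'
    have h4 := inflate_forward (g := g) (i := i) (j := j) (c := c) (m := m) (a := a)
      (t := k + 1 - i) (by omega) (by omega)
    have h5 := ha.forwardStrand_mem hc (t := k + 1 - i) (by omega) (by omega)
    rw [show i + (k + 1 - i) - 1 = k by omega] at h4
    rw [h4]
    exact ⟨h5.1, by omega, h5.2.2.2.2⟩
  have hbw : ∀ k, j + m ≤ k + 1 → k + 1 < j + 2 * m → c ≤ inflate g i j c m a k ∧
      inflate g i j c m a k < c + 2 * m ∧ ((inflate g i j c m a k + 1 - c) % 4 = 2 ∨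
        (inflate g i j c m a k + 1 - c) % 4 = 3) := by
    intro k hk hk'
    have h4 := inflate_backward (g := g) (i := i) (j := j) (c := c) (m := m) (a := a) hij
      (t := j + 2 * m - 1 - k) (by omega) (by omega)
    have h5 := ha.backwardStrand_mem hc (t := j + 2 * m - 1 - k) (by omega) (by omega)
    rw [show j + 2 * m - 1 - (j + 2 * m - 1 - k) = k by omega] at h4
    rw [h4]
    exact ⟨h5.1, by omega, h5.2.2.2.2⟩
  have hinj : ∀ k l, k₁ ≤ k → k ≤ k₂ → k₁ ≤ l → l ≤ k₂ →
      inflate g i j c m a k = inflate g i j c m a l → k = l := fun k l hk hk' hl hl' ↦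
    hg.inflate_injOn ha hm (by omega) (by omega) (by omega) (by omega)
  -- the position of a strand value in the window
  have hcls : ∀ v, lo ≤ v → v ≤ lo + d → c ≤ v → v < c + 2 * m →
      (∃ k, k₁ ≤ k ∧ k ≤ k₂ ∧ i ≤ k ∧ k < i + m ∧ inflate g i j c m a k = v ∧
        ((v + 1 - c) % 4 = 0 ∨ (v + 1 - c) % 4 = 1)) ∨
      (∃ k, k₁ ≤ k ∧ k ≤ k₂ ∧ j + m ≤ k + 1 ∧ k + 1 < j + 2 * m ∧ inflate g i j c m a k = v ∧
        ((v + 1 - c) % 4 = 2 ∨ (v + 1 - c) % 4 = 3)) := by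
    intro v hv hv' hcv hvc
    obtain ⟨k, hk, hk', rfl⟩ := hsurj v hv hv'
    have h4 := hout k (by omega) (by omega)
    by_cases h5 : i ≤ k ∧ k < i + m
    · exact Or.inl ⟨k, hk, hk', h5.1, h5.2, rfl, (hfw k h5.1 h5.2).2.2⟩
    by_cases h6 : j + m ≤ k + 1 ∧ k + 1 < j + 2 * m
    · exact Or.inr ⟨k, hk, hk', h6.1, h6.2, rfl, (hbw k h6.1 h6.2).2.2⟩
    · omega
  by_cases hF : k₁ < i + m ∧ i ≤ k₂
  · by_cases hB : k₁ + 1 < j + 2 * m ∧ j + m ≤ k₂ + 1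
    · -- both strands are met
      obtain ⟨x, hx1, hx2, hx3⟩ := hg.low
      obtain ⟨y, hy1, hy2, hy3⟩ := hg.high
      have hx4 := hg.inflate_of_between hm1 a hx1 hx2
      have hy4 := hg.inflate_of_between hm1 a hy1 hy2
      have hx5 := h (x + m - 1) (by omega) (by omega)
      have hy5 := h (y + m - 1) (by omega) (by omega)
      have hk1 : k₁ ≤ i := by
        by_contra hcon
        have h4 := hfw i le_rfl (by omega)
        obtain ⟨k, hk, hk', hk2⟩ := hsurj (inflate g i j c m a i) (by omega) (by omega)
        have := hg.inflate_injOn ha hm (by omega) (by omega) (by omega) (by omega) hk2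
        omega
      have hk2 : j + 2 * m - 2 ≤ k₂ := by
        by_contra hcon
        have h4 := hbw (j + 2 * m - 2) (by omega) (by omega)
        obtain ⟨k, hk, hk', hk2⟩ := hsurj (inflate g i j c m a (j + 2 * m - 2))
          (by omega) (by omega)
        have := hg.inflate_injOn ha hm (by omega) (by omega) (by omega) (by omega) hk2
        omega
      refine hg.not_interval (k₁ := k₁) (k₂ := k₂ + 2 - 2 * m) (lo := lo) (d := d + 2 - 2 * m)
        h1 (by omega) (by omega) (by omega) (by omega) ?_
      intro k hk hk'
      rcases lt_trichotomy k i with h4 | h4 | h4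
      · have h5 := hg.inflate_of_lt hm1 a (by omega) h4
        have := h k (by omega) (by omega)
        omega
      · rw [h4, hg.left]
        omega
      rcases lt_trichotomy k j with h6 | h6 | h6
      · have h5 := hg.inflate_of_between hm1 a h4 h6
        have := h (k + m - 1) (by omega) (by omega)
        omega
      · rw [h6, hg.right]
        omega
      · have h5 := hg.inflate_of_gt hm1 a h6 (by omega)
        have := h (k + 2 * m - 2) (by omega) (by omega)
        omega
    · -- only the forward strand is met
      have hcls' : ∀ v, lo ≤ v → v ≤ lo + d → c ≤ v → v < c + 2 * m →
          ((v + 1 - c) % 4 = 0 ∨ (v + 1 - c) % 4 = 1) := by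
        intro v hv hv' hcv hvc
        rcases hcls v hv hv' hcv hvc with ⟨k, hk, hk', -, -, -, h4⟩ | ⟨k, hk, hk', h4, h5, -⟩
        · exact h4
        · omega
      obtain ⟨k, hk, hk', hk2, hk3⟩ : ∃ k, k₁ ≤ k ∧ k ≤ k₂ ∧ i ≤ k ∧ k < i + m :=
        ⟨max k₁ i, by omega, by omega, by omega, by omega⟩
      have h4 := hfw k hk2 hk3
      have h5 := h k hk hk'
      have h6 : lo < c ∧ lo + d = c := by
        have a1 := hcls' (lo + 1)
        have a2 := hcls' (lo + 2)
        have a3 := hcls' lo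
        have a4 := hcls' (c + 1)
        have a5 := hcls' (c + 2 * m - 1)
        omega
      have huniq : ∀ l, k₁ ≤ l → l ≤ k₂ → i ≤ l → l < i + m → l = k := by
        intro l hl hl' hl2 hl3
        have := hfw l hl2 hl3
        have := h l hl hl'
        exact hinj l k hl hl' hk hk' (by omega)
      have h7 : k₂ = i ∨ k₁ = i + m - 1 := by
        have b1 := huniq (k + 1)
        have b2 := huniq (k - 1)
        omega
      rcases h7 with h7 | h7
      · refine hg.not_interval (k₁ := k₁) (k₂ := k₂) (lo := lo) (d := d)
          h1 (by omega) (by omega) (by omega) (by omega) ?_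
        intro l hl hl'
        rcases hl'.eq_or_lt with h8 | h8
        · rw [h8, h7, hg.left]
          omega
        · have := hg.inflate_of_lt hm1 a (by omega) (show l < i by omega)
          have := h l hl hl'
          omega
      · refine hg.not_interval (k₁ := i) (k₂ := k₂ + 1 - m) (lo := lo) (d := d)
          hi (by omega) (by omega) (by omega) (by omega) ?_
        intro l hl hl'
        rcases hl.eq_or_lt with h8 | h8
        · rw [← h8, hg.left]
          omega
        · have := hg.inflate_of_between hm1 a h8 (by omega)
          have := h (l + m - 1) (by omega) (by omega)
          omega
  · by_cases hB : k₁ + 1 < j + 2 * m ∧ j + m ≤ k₂ + 1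
    · -- only the backward strand is met
      have hcls' : ∀ v, lo ≤ v → v ≤ lo + d → c ≤ v → v < c + 2 * m →
          ((v + 1 - c) % 4 = 2 ∨ (v + 1 - c) % 4 = 3) := by
        intro v hv hv' hcv hvc
        rcases hcls v hv hv' hcv hvc with ⟨k, hk, hk', h4, h5, -⟩ | ⟨k, hk, hk', -, -, -, h4⟩
        · omega
        · exact h4
      obtain ⟨k, hk, hk', hk2, hk3⟩ : ∃ k, k₁ ≤ k ∧ k ≤ k₂ ∧ j + m ≤ k + 1 ∧ k + 1 < j + 2 * m :=
        ⟨max k₁ (j + m - 1), by omega, by omega, by omega, by omega⟩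
      have h4 := hbw k hk2 hk3
      have h5 := h k hk hk'
      have h6 : lo + 1 = c + 2 * m := by
        have a1 := hcls' (lo + 1)
        have a2 := hcls' (lo + 2)
        have a3 := hcls' lo
        have a4 := hcls' c
        have a5 := hcls' (c + 2 * m - 2)
        omega
      have huniq : ∀ l, k₁ ≤ l → l ≤ k₂ → j + m ≤ l + 1 → l + 1 < j + 2 * m → l = k := by
        intro l hl hl' hl2 hl3
        have := hbw l hl2 hl3
        have := h l hl hl'
        exact hinj l k hl hl' hk hk' (by omega)
      have h7 : k₂ = j + m - 1 ∨ k₁ = j + 2 * m - 2 := by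
        have b1 := huniq (k + 1)
        have b2 := huniq (k - 1)
        omega
      rcases h7 with h7 | h7
      · refine hg.not_interval (k₁ := k₁ + 1 - m) (k₂ := j) (lo := c + 1) (d := d)
          (by omega) (by omega) (by omega) (by omega) (by omega) ?_
        intro l hl hl'
        rcases hl'.eq_or_lt with h8 | h8
        · rw [h8, hg.right]
          omega
        · have := hg.inflate_of_between hm1 a (k := l) (by omega) h8
          have := h (l + m - 1) (by omega) (by omega)
          omega
      · refine hg.not_interval (k₁ := j) (k₂ := k₂ + 2 - 2 * m) (lo := c + 1) (d := d)
          (by omega) (by omega) (by omega) (by omega) (by omega) ?_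
        intro l hl hl'
        rcases hl.eq_or_lt with h8 | h8
        · rw [← h8, hg.right]
          omega
        · have := hg.inflate_of_gt hm1 a h8 (by omega)
          have := h (l + 2 * m - 2) (by omega) (by omega)
          omega
    · -- no strand is met
      have hside : lo + d < c ∨ c + 2 * m ≤ lo := by
        have h4 : ∀ v, lo ≤ v → v ≤ lo + d → c ≤ v → v < c + 2 * m → False := by
          intro v hv hv' hcv hvc
          rcases hcls v hv hv' hcv hvc with ⟨k, hk, hk', h4, h5, -⟩ | ⟨k, hk, hk', h4, h5, -⟩ <;>
            omega
        by_contra hcon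
        rcases le_or_gt c lo with h5 | h5
        · exact h4 lo (by omega) (by omega) h5 (by omega)
        · exact h4 c (by omega) (by omega) le_rfl (by omega)
      obtain ⟨lo', hlo'⟩ : ∃ lo', (lo + d < c ∧ lo' = lo) ∨
          (c + 2 * m ≤ lo ∧ lo' + 2 * m = lo + 2) := by
        rcases hside with h4 | h4
        · exact ⟨lo, Or.inl ⟨h4, rfl⟩⟩
        · exact ⟨lo + 2 - 2 * m, Or.inr ⟨h4, by omega⟩⟩
      have hcase : k₂ < i ∨ (i + m ≤ k₁ ∧ k₂ + 1 < j + m) ∨ j + 2 * m ≤ k₁ + 1 := by omega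
      rcases hcase with h4 | ⟨h4, h5⟩ | h4
      · refine hg.not_interval (k₁ := k₁) (k₂ := k₂) (lo := lo') (d := d)
          (by omega) (by omega) (by omega) (by omega) (by omega) ?_
        intro l hl hl'
        have := hg.inflate_of_lt hm1 a (k := l) (by omega) (by omega)
        have := h l (by omega) (by omega)
        omega
      · refine hg.not_interval (k₁ := k₁ + 1 - m) (k₂ := k₂ + 1 - m) (lo := lo') (d := d)
          (by omega) (by omega) (by omega) (by omega) (by omega) ?_
        intro l hl hl'
        have := hg.inflate_of_between hm1 a (k := l) (by omega) (by omega)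
        have := h (l + m - 1) (by omega) (by omega)
        omega
      · refine hg.not_interval (k₁ := k₁ + 2 - 2 * m) (k₂ := k₂ + 2 - 2 * m) (lo := lo') (d := d)
          (by omega) (by omega) (by omega) (by omega) (by omega) ?_
        intro l hl hl'
        have := hg.inflate_of_gt hm1 a (k := l) (by omega) (by omega)
        have := h (l + 2 * m - 2) (by omega) (by omega)
        omega

end InflateSimple

section Counting

variable {N : ℕ} {g : ℕ → ℕ} {i j c m : ℕ} {a : ℕ → ℕ}

theorem IsGadget.inflate_isIrreducibleMeander (hg : IsGadget N g i j c)
    (ha : IsOpenMeandricPerm m a) (hm : m % 2 = 1) (hm3 : 3 ≤ m) :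
    IsIrreducibleMeander (N + 2 * m - 2) (inflate g i j c m a) := by
  rintro ⟨k₁, k₂, hk, h1, hn, h2, h3, h⟩
  set lo := (Finset.Icc k₁ k₂).inf' (Finset.nonempty_Icc.mpr hk.le) (inflate g i j c m a)
  have hb : ∀ k, k₁ ≤ k → k ≤ k₂ →
      lo ≤ inflate g i j c m a k ∧ inflate g i j c m a k ≤ lo + (k₂ - k₁) := by
    intro k hk1 hk2
    have hmem : k ∈ Finset.Icc k₁ k₂ := Finset.mem_Icc.2 ⟨hk1, hk2⟩
    have h4 : lo ≤ inflate g i j c m a k := Finset.inf'_le _ hmem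
    have h5 := Finset.le_sup' (inflate g i j c m a) hmem
    exact ⟨h4, by omega⟩
  refine hg.inflate_simple ha hm hm3 h1 hn (lo := lo) (d := k₂ - k₁) h2 (by omega) (by omega) hb ?_
  have hs : Set.SurjOn (inflate g i j c m a) (Finset.Icc k₁ k₂ : Finset ℕ)
      (Finset.Icc lo (lo + (k₂ - k₁)) : Finset ℕ) := by
    apply Finset.surjOn_of_injOn_of_card_le
    · intro k hk
      rw [Finset.coe_Icc, Set.mem_Icc] at hk ⊢
      exact hb k hk.1 hk.2
    · intro k hk l hl hkl
      rw [Finset.coe_Icc, Set.mem_Icc] at hk hl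
      exact hg.inflate_injOn ha hm (by omega) (by omega) (by omega) (by omega) hkl
    · rw [Nat.card_Icc, Nat.card_Icc]
      omega
  intro v hv hv'
  obtain ⟨k, hk, hkv⟩ := hs (by rw [Finset.coe_Icc]; exact ⟨hv, hv'⟩)
  rw [Finset.coe_Icc, Set.mem_Icc] at hk
  exact ⟨k, hk.1, hk.2, hkv⟩

theorem finite_openMeandricPerm (n : ℕ) :
    {a : ℕ → ℕ | IsOpenMeandricPerm n a ∧ ∀ i, i < 1 ∨ n < i → a i = 0}.Finite := by
  refine Set.Finite.of_injOn (f := fun (a : ℕ → ℕ) (k : Fin (n + 1)) ↦ Fin.ofNat (n + 1) (a k))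
    (t := Set.univ) (fun _ _ ↦ Set.mem_univ _) ?_ Set.finite_univ
  rintro a ⟨ha, ha0⟩ b ⟨hb, hb0⟩ hab
  funext k
  by_cases hk : 1 ≤ k ∧ k ≤ n
  · have h := congrArg Fin.val (congrFun hab ⟨k, by omega⟩)
    have h1 := ha.2.1 k hk.1 hk.2
    have h2 := hb.2.1 k hk.1 hk.2
    simpa [Fin.ofNat, Nat.mod_eq_of_lt (show a k < n + 1 by omega),
      Nat.mod_eq_of_lt (show b k < n + 1 by omega)] using h
  · rw [ha0 k (by omega), hb0 k (by omega)]

theorem finite_irreducibleMeander (n : ℕ) :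
    {a : ℕ → ℕ | IsOpenMeandricPerm n a ∧ IsIrreducibleMeander n a ∧
      ∀ i, i < 1 ∨ n < i → a i = 0}.Finite :=
  (finite_openMeandricPerm n).subset fun _ h ↦ ⟨h.1, h.2.2⟩

theorem irrMeanderCount_le_openMeanderCount (n : ℕ) : irrMeanderCount n ≤ openMeanderCount n :=
  Set.ncard_le_ncard (fun _ h ↦ ⟨h.1, h.2.2⟩) (finite_openMeandricPerm n)

theorem IsGadget.openMeanderCount_le (hg : IsGadget N g i j c) (hm : m % 2 = 1) (hm3 : 3 ≤ m) :
    openMeanderCount m ≤ irrMeanderCount (N + 2 * m - 2) := by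
  have hc := hg.one_le_c
  have hi := hg.one_le
  have hij := hg.lt
  have hjN := hg.le
  refine Set.ncard_le_ncard_of_injOn (inflate g i j c m) ?_ ?_ (finite_irreducibleMeander _)
  · rintro a ⟨ha, -⟩
    refine ⟨hg.inflate_isOpenMeandricPerm ha hm, hg.inflate_isIrreducibleMeander ha hm hm3, ?_⟩
    rintro k (hk | hk)
    · rw [inflate, if_pos (by omega), hg.zero k (Or.inl hk), blowUp_of_lt (by omega)]
    · rw [inflate, if_neg (by omega), if_neg (by omega), if_neg (by omega), if_neg (by omega),
        hg.zero _ (Or.inr (by omega)), blowUp_of_lt (by omega)]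
  · rintro a ⟨ha, ha0⟩ b ⟨hb, hb0⟩ hab
    funext t
    by_cases ht : 1 ≤ t ∧ t ≤ m
    · have h := congrFun hab (i + t - 1)
      rw [inflate_forward ht.1 ht.2, inflate_forward ht.1 ht.2, forwardStrand, forwardStrand] at h
      have := ha.strand_mem ht.1 ht.2
      have := hb.strand_mem ht.1 ht.2
      omega
    · rw [ha0 t (by omega), hb0 t (by omega)]

/-- The one-based sequence with the entries of a list, vanishing elsewhere. -/
def seqOfList (l : List ℕ) (k : ℕ) : ℕ := (0 :: l).getD k 0

/-- Bounded, and hence decidable, form of the conditions for a gadget given by a list. -/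
theorem isGadget_seqOfList (l : List ℕ) (i j c : ℕ) (hl : 1 ≤ l.length)
    (h1 : ∀ k ≤ l.length, 1 ≤ k → 1 ≤ seqOfList l k ∧ seqOfList l k ≤ l.length ∧
      seqOfList l k % 2 = k % 2)
    (h2 : ∀ k ≤ l.length, ∀ k' ≤ l.length, 1 ≤ k → 1 ≤ k' → seqOfList l k = seqOfList l k' → k = k')
    (h3 : ∀ k < l.length, ∀ k' < l.length, 1 ≤ k → 1 ≤ k' → k % 2 = k' % 2 →
      ¬ ((min (seqOfList l k) (seqOfList l (k + 1)) < seqOfList l k' ∧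
            seqOfList l k' < max (seqOfList l k) (seqOfList l (k + 1))) ∧
          ¬ (min (seqOfList l k) (seqOfList l (k + 1)) < seqOfList l (k' + 1) ∧
            seqOfList l (k' + 1) < max (seqOfList l k) (seqOfList l (k + 1)))) ∧
      ¬ ((min (seqOfList l k) (seqOfList l (k + 1)) < seqOfList l (k' + 1) ∧
            seqOfList l (k' + 1) < max (seqOfList l k) (seqOfList l (k + 1))) ∧
          ¬ (min (seqOfList l k) (seqOfList l (k + 1)) < seqOfList l k' ∧
            seqOfList l k' < max (seqOfList l k) (seqOfList l (k + 1)))))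
    (h4 : ∀ k < l.length, 1 ≤ k → k % 2 = 0 →
      ¬ (min (seqOfList l k) (seqOfList l (k + 1)) < seqOfList l 1 ∧
        seqOfList l 1 < max (seqOfList l k) (seqOfList l (k + 1))))
    (h5 : ∀ k < l.length, 1 ≤ k → k % 2 = l.length % 2 →
      ¬ (min (seqOfList l k) (seqOfList l (k + 1)) < seqOfList l l.length ∧
        seqOfList l l.length < max (seqOfList l k) (seqOfList l (k + 1))))
    (h6 : ∀ k₁ ≤ l.length, ∀ k₂ ≤ l.length, 1 ≤ k₁ → k₁ + 3 ≤ k₂ → ¬ (k₁ = 1 ∧ k₂ = l.length) →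
      ∃ k ≤ k₂, ∃ k' ≤ k₂, k₁ ≤ k ∧ k₁ ≤ k' ∧ seqOfList l k' + (k₂ - k₁) < seqOfList l k)
    (h7 : 1 ≤ i ∧ i < j ∧ j ≤ l.length ∧ i % 2 = 1 ∧ seqOfList l i = c ∧ seqOfList l j = c + 1)
    (h8 : ∃ k < j, i < k ∧ seqOfList l k < c) (h9 : ∃ k < j, i < k ∧ c + 1 < seqOfList l k) :
    IsGadget l.length (seqOfList l) i j c where
  perm := by
    refine ⟨hl, fun k hk hk' ↦ ⟨(h1 k hk' hk).1, (h1 k hk' hk).2.1⟩,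
      fun k k' hk hkl hk' hkl' ↦ h2 k hkl k' hkl' hk hk', fun k hk hk' ↦ (h1 k hk' hk).2.2,
      ?_, ?_, ?_, ?_⟩
    · intro k k' hk hkl hk' hkl'
      rw [Nat.odd_iff] at hk hk'
      have := h3 k hkl k' hkl' (by omega) (by omega) (by omega)
      rw [arcsCross_iff]
      exact not_or.2 this
    · intro k k' hk hk1 hkl hk' hk1' hkl'
      rw [Nat.even_iff] at hk hk'
      have := h3 k hkl k' hkl' (by omega) (by omega) (by omega)
      rw [arcsCross_iff]
      exact not_or.2 this
    · intro k hk hk1 hkl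
      exact h4 k hkl hk1 (Nat.even_iff.1 hk)
    · split_ifs with hN
      · intro k hk hk1 hkl
        rw [Nat.even_iff] at hk hN
        exact h5 k hkl hk1 (by omega)
      · intro k hk hkl
        rw [Nat.even_iff] at hN
        rw [Nat.odd_iff] at hk
        exact h5 k hkl (by omega) (by omega)
  zero := by
    rintro k (hk | hk)
    · obtain rfl : k = 0 := by omega
      rfl
    · exact List.getD_eq_default _ _ (by simp; omega)
  one_le := h7.1
  lt := h7.2.1
  le := h7.2.2.1
  odd := h7.2.2.2.1
  left := h7.2.2.2.2.1
  right := h7.2.2.2.2.2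
  low := by
    obtain ⟨k, hk, hk'⟩ := h8
    exact ⟨k, hk'.1, hk, hk'.2⟩
  high := by
    obtain ⟨k, hk, hk'⟩ := h9
    exact ⟨k, hk'.1, hk, hk'.2⟩
  simple := by
    intro k₁ k₂ hk1 hk2 hk3 hne
    obtain ⟨k, hk, k', hk', h10, h11, h12⟩ := h6 k₁ (by omega) k₂ hk2 hk1 hk3 hne
    exact ⟨k, k', h10, hk, h11, hk', h12⟩

set_option synthInstance.maxHeartbeats 400000 in
set_option synthInstance.maxSize 1000 in
theorem isGadget_six : IsGadget 6 (seqOfList [3, 2, 1, 6, 5, 4]) 1 6 3 := by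
  apply isGadget_seqOfList [3, 2, 1, 6, 5, 4] <;> decide +kernel

set_option synthInstance.maxHeartbeats 400000 in
set_option synthInstance.maxSize 1000 in
theorem isGadget_eight : IsGadget 8 (seqOfList [3, 6, 7, 2, 1, 8, 5, 4]) 1 8 3 := by
  apply isGadget_seqOfList [3, 6, 7, 2, 1, 8, 5, 4] <;> decide +kernel

set_option synthInstance.maxHeartbeats 400000 in
set_option synthInstance.maxSize 1000 in
theorem isGadget_thirteen :
    IsGadget 13 (seqOfList [3, 4, 13, 8, 9, 12, 5, 2, 1, 6, 11, 10, 7]) 5 12 9 := by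
  apply isGadget_seqOfList [3, 4, 13, 8, 9, 12, 5, 2, 1, 6, 11, 10, 7] <;> decide +kernel

set_option synthInstance.maxHeartbeats 400000 in
set_option synthInstance.maxSize 1000 in
theorem isGadget_fifteen :
    IsGadget 15 (seqOfList [3, 4, 5, 8, 9, 2, 1, 10, 13, 14, 7, 6, 15, 12, 11]) 3 12 5 := by
  apply isGadget_seqOfList [3, 4, 5, 8, 9, 2, 1, 10, 13, 14, 7, 6, 15, 12, 11] <;> decide +kernel

theorem exists_openMeanderCount_le_irrMeanderCount {n : ℕ} (hn : 19 ≤ n) :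
    ∃ m, n ≤ 2 * m + 13 ∧ openMeanderCount m ≤ irrMeanderCount n := by
  have key : ∀ N, N ≤ 15 → (∀ m, m % 2 = 1 → 3 ≤ m →
      openMeanderCount m ≤ irrMeanderCount (N + 2 * m - 2)) → n % 4 = N % 4 →
      ∃ m, n ≤ 2 * m + 13 ∧ openMeanderCount m ≤ irrMeanderCount n := by
    intro N hN h hnN
    refine ⟨(n + 2 - N) / 2, by omega, ?_⟩
    have := h ((n + 2 - N) / 2) (by omega) (by omega)
    rwa [show N + 2 * ((n + 2 - N) / 2) - 2 = n by omega] at this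
  have h4 : n % 4 = 6 % 4 ∨ n % 4 = 8 % 4 ∨ n % 4 = 13 % 4 ∨ n % 4 = 15 % 4 := by omega
  rcases h4 with h | h | h | h
  · exact key 6 (by omega) (fun m ↦ isGadget_six.openMeanderCount_le) h
  · exact key 8 (by omega) (fun m ↦ isGadget_eight.openMeanderCount_le) h
  · exact key 13 (by omega) (fun m ↦ isGadget_thirteen.openMeanderCount_le) h
  · exact key 15 (by omega) (fun m ↦ isGadget_fifteen.openMeanderCount_le) h

end Counting

theorem pow_le_of_lt_rpow_one_div {x r : ℝ} {n : ℕ} (hr : 0 ≤ r) (hx : 0 ≤ x) (hn : n ≠ 0)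
    (h : r < x ^ (1 / (n : ℝ))) : r ^ n ≤ x := by
  calc r ^ n ≤ (x ^ (1 / (n : ℝ))) ^ n := pow_le_pow_left₀ hr h.le n
    _ = x := by rw [one_div, Real.rpow_inv_natCast_pow hx hn]

/-- If `M_n ^ (1/n)` tends to `L`, then `M_n` eventually exceeds `q ^ (2 n + d)` once `q² < L`. -/
theorem eventually_pow_le_of_tendsto {u : ℕ → ℝ} (hu : ∀ n, 0 ≤ u n) {L q : ℝ}
    (hL : Tendsto (fun n : ℕ ↦ u n ^ (1 / (n : ℝ))) atTop (nhds L)) (hq : 0 < q)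
    (hqL : q ^ 2 < L) (d : ℕ) : ∀ᶠ n in atTop, q ^ (2 * n + d) ≤ u n := by
  obtain ⟨r, hqr, hrL⟩ := exists_between hqL
  have hq2 : 0 < q ^ 2 := by positivity
  have h1 : ∀ᶠ n : ℕ in atTop, q ^ d ≤ (r / q ^ 2) ^ n :=
    (tendsto_pow_atTop_atTop_of_one_lt ((one_lt_div hq2).2 hqr)).eventually_ge_atTop _
  filter_upwards [h1, hL.eventually_const_lt hrL, eventually_ne_atTop 0] with n h2 h3 h4
  calc q ^ (2 * n + d) = (q ^ 2) ^ n * q ^ d := by rw [pow_add, pow_mul]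
    _ ≤ (q ^ 2) ^ n * (r / q ^ 2) ^ n := by gcongr
    _ = r ^ n := by rw [← mul_pow, mul_div_cancel₀ _ hq2.ne']
    _ ≤ u n := pow_le_of_lt_rpow_one_div (hq2.trans hqr).le (hu n) h4 h3

/-- If `L = lim (M n)^(1/n)` exists and `L ≥ √11.38`, then
`liminf (M^{Irr} n)^(1/n) ≥ 11.38^(1/4)`. -/
theorem irr_meander_growth_lower_bound_numeric (L : ℝ)
    (hL : Tendsto (fun n : ℕ => (openMeanderCount n : ℝ) ^ (1 / (n : ℝ))) atTop (nhds L))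
    (hL' : L ≥ Real.sqrt 11.38) :
    liminf (fun n : ℕ => (irrMeanderCount n : ℝ) ^ (1 / (n : ℝ))) atTop ≥
      (11.38 : ℝ) ^ ((1 : ℝ) / 4) := by
  have hbdd : IsBoundedUnder (· ≤ ·) atTop
      (fun n : ℕ => (irrMeanderCount n : ℝ) ^ (1 / (n : ℝ))) :=
    hL.isBoundedUnder_le.mono_le <| Eventually.of_forall fun n ↦
      Real.rpow_le_rpow (Nat.cast_nonneg _)
        (Nat.cast_le.2 (irrMeanderCount_le_openMeanderCount n)) (by positivity)
  refine le_of_forall_lt_imp_le_of_dense fun q hq ↦ ?_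
  refine (le_max_left q 1).trans ?_
  have h1 : (1 : ℝ) < 11.38 ^ ((1 : ℝ) / 4) := Real.one_lt_rpow (by norm_num) (by norm_num)
  have hq' : max q 1 < 11.38 ^ ((1 : ℝ) / 4) := max_lt hq h1
  have hpos : 1 ≤ max q 1 := le_max_right _ _
  generalize max q 1 = p at hq' hpos ⊢
  have hp0 : 0 < p := by linarith
  have hpL : p ^ 2 < L := by
    refine lt_of_lt_of_le ?_ hL'
    calc p ^ 2 < ((11.38 : ℝ) ^ ((1 : ℝ) / 4)) ^ 2 := by gcongr
      _ = Real.sqrt 11.38 := by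
        rw [Real.sqrt_eq_rpow, ← Real.rpow_mul_natCast (by norm_num)]
        norm_num
  refine le_liminf_of_le hbdd.isCoboundedUnder_ge ?_
  obtain ⟨K, hK⟩ := eventually_atTop.1
    (eventually_pow_le_of_tendsto (fun n ↦ Nat.cast_nonneg (openMeanderCount n)) hL hp0 hpL 13)
  filter_upwards [eventually_ge_atTop (2 * K + 19)] with n hn
  obtain ⟨m, hnm, hm⟩ := exists_openMeanderCount_le_irrMeanderCount (show 19 ≤ n by omega)
  have h2 : p ^ n ≤ (irrMeanderCount n : ℝ) :=
    calc p ^ n ≤ p ^ (2 * m + 13) := pow_le_pow_right₀ hpos hnm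
      _ ≤ openMeanderCount m := hK m (by omega)
      _ ≤ irrMeanderCount n := Nat.cast_le.2 hm
  calc p = (p ^ n) ^ (1 / (n : ℝ)) := by
        rw [one_div, Real.pow_rpow_inv_natCast hp0.le (by omega)]
    _ ≤ (irrMeanderCount n : ℝ) ^ (1 / (n : ℝ)) := by gcongr
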